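/- arXiv:2304.10364 — 2 statements merged into one kernel-verified Lean document; each statement's English description precedes it below -/
import Mathlib

section
/- Fix reals V > 0 and E > 0, and for λ > 0 set C′(λ) = √(π√λ/(3√V·E)) · exp(3VE²/(4λ)). Then, as λ → 0⁺, (1/C′(λ)) ∫_ℝ x·exp(−(λV/4)x⁴ + Vx·E^{3/2}/√λ) dx − ( √2·√E/(λ^{3/4}V^{1/4}) − 5λ^{1/4}/(18√2·E^{3/2}·V^{5/4}) − 455λ^{5/4}/(1296√2·E^{7/2}·V^{9/4}) ) = O(λ^{9/4}). -/
open MeasureTheory Filter Asymptotics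

lemma sp_exp_taylor (n : ℕ) : ∀ u : ℝ,
    |Real.exp u - ∑ i ∈ Finset.range n, u ^ i / (i.factorial : ℝ)| ≤ |u| ^ n * max 1 (Real.exp u) := by
  induction n with
  | zero =>
    intro u
    simp [abs_of_pos (Real.exp_pos u)]
  | succ n ih =>
    intro u
    have hd : ∀ x : ℝ, HasDerivAt
        (fun u : ℝ => Real.exp u - ∑ i ∈ Finset.range (n+1), u ^ i / (i.factorial : ℝ))
        (Real.exp x - ∑ i ∈ Finset.range n, x ^ i / (i.factorial : ℝ)) x := by
      intro x
      refine (Real.hasDerivAt_exp x).sub ?_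
      have h1 : (fun u : ℝ => ∑ i ∈ Finset.range (n+1), u ^ i / (i.factorial : ℝ))
          = fun u : ℝ => (∑ i ∈ Finset.range n, u ^ (i+1) / ((i+1).factorial : ℝ)) + 1 := by
        funext u
        rw [Finset.sum_range_succ']
        simp
      rw [h1]
      refine HasDerivAt.add_const _ ?_
      refine HasDerivAt.fun_sum ?_
      intro i _
      have h2 := ((hasDerivAt_pow (i+1) x).div_const ((i+1).factorial : ℝ))
      refine h2.congr_deriv ?_
      rw [Nat.factorial_succ]
      push_cast
      have : (i.factorial : ℝ) ≠ 0 := by positivity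
      have : (i + 1 : ℝ) ≠ 0 := by positivity
      field_simp
    have hb : ∀ x ∈ Set.uIcc 0 u,
        ‖Real.exp x - ∑ i ∈ Finset.range n, x ^ i / (i.factorial : ℝ)‖
          ≤ |u| ^ n * max 1 (Real.exp u) := by
      intro x hx
      rw [Real.norm_eq_abs]
      have hxu : |x| ≤ |u| := by
        have := Set.abs_sub_left_of_mem_uIcc hx
        simpa using this
      refine (ih x).trans ?_
      have : max 1 (Real.exp x) ≤ max 1 (Real.exp u) := by
        rcases le_total 0 u with h | h
        · rw [Set.uIcc_of_le h] at hx
          exact max_le_max le_rfl (Real.exp_le_exp.2 hx.2)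
        · rw [Set.uIcc_of_ge h] at hx
          exact max_le (le_max_left _ _) ((Real.exp_le_one_iff.2 hx.2).trans (le_max_left _ _))
      gcongr
    have := Convex.norm_image_sub_le_of_norm_hasDerivWithin_le
      (fun x _ => (hd x).hasDerivWithinAt) hb (convex_uIcc 0 u) Set.left_mem_uIcc
      Set.right_mem_uIcc
    simp only [Real.norm_eq_abs, sub_zero] at this
    have h0 : Real.exp 0 - ∑ i ∈ Finset.range (n+1), (0:ℝ) ^ i / (i.factorial : ℝ) = 0 := by
      rw [Finset.sum_range_succ']
      simp
    rw [h0, sub_zero] at this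
    rw [pow_succ]
    linarith

/-- polynomially bounded, uniformly for `|ε| ≤ 1` -/
def SpPB (F : ℝ → ℝ → ℝ) : Prop :=
  ∃ C : ℝ, ∃ N : ℕ, 0 ≤ C ∧ ∀ e s : ℝ, |e| ≤ 1 → |F e s| ≤ C * (1 + s ^ 2) ^ N

lemma SpPB.const (c : ℝ) : SpPB (fun _ _ => c) :=
  ⟨|c|, 0, abs_nonneg _, by simp⟩

lemma SpPB.eps : SpPB (fun e _ => e) :=
  ⟨1, 0, by norm_num, by simp⟩

lemma SpPB.var : SpPB (fun _ s => s) :=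
  ⟨1, 1, by norm_num, fun e s _ => by
    rw [abs_le]; constructor <;> nlinarith [sq_nonneg (s+1), sq_nonneg (s-1)]⟩

lemma SpPB.add {F G : ℝ → ℝ → ℝ} (hF : SpPB F) (hG : SpPB G) :
    SpPB (fun e s => F e s + G e s) := by
  obtain ⟨C, N, hC, h⟩ := hF
  obtain ⟨D, M, hD, h'⟩ := hG
  refine ⟨C + D, N + M, by positivity, fun e s he => ?_⟩
  have h1 : (1:ℝ) ≤ 1 + s ^ 2 := by nlinarith [sq_nonneg s]
  have h2 : (1 + s^2) ^ N ≤ (1 + s^2) ^ (N+M) := pow_le_pow_right₀ h1 (by omega)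
  have h3 : (1 + s^2) ^ M ≤ (1 + s^2) ^ (N+M) := pow_le_pow_right₀ h1 (by omega)
  calc |F e s + G e s| ≤ |F e s| + |G e s| := abs_add_le _ _
    _ ≤ C * (1 + s^2) ^ N + D * (1 + s^2) ^ M := add_le_add (h e s he) (h' e s he)
    _ ≤ C * (1 + s^2) ^ (N+M) + D * (1 + s^2) ^ (N+M) := by gcongr
    _ = _ := by ring

lemma SpPB.mul {F G : ℝ → ℝ → ℝ} (hF : SpPB F) (hG : SpPB G) :
    SpPB (fun e s => F e s * G e s) := by
  obtain ⟨C, N, hC, h⟩ := hF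
  obtain ⟨D, M, hD, h'⟩ := hG
  refine ⟨C * D, N + M, by positivity, fun e s he => ?_⟩
  rw [abs_mul]
  calc |F e s| * |G e s| ≤ (C * (1 + s^2) ^ N) * (D * (1 + s^2) ^ M) :=
        mul_le_mul (h e s he) (h' e s he) (abs_nonneg _) (by positivity)
    _ = _ := by ring

lemma SpPB.pow {F : ℝ → ℝ → ℝ} (hF : SpPB F) (n : ℕ) :
    SpPB (fun e s => F e s ^ n) := by
  induction n with
  | zero => simpa using SpPB.const 1
  | succ n ih => simpa only [pow_succ] using ih.mul hF

lemma sp_int_pow {b : ℝ} (hb : 0 < b) (n : ℕ) :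
    Integrable (fun s : ℝ => s ^ n * Real.exp (-b * s ^ 2)) := by
  have := integrable_rpow_mul_exp_neg_mul_sq hb (s := n)
    (by have : (0:ℝ) ≤ n := by positivity
        linarith)
  simpa only [Real.rpow_natCast] using this

lemma sp_int_pow2 {b : ℝ} (hb : 0 < b) (N : ℕ) : ∀ n : ℕ,
    Integrable (fun s : ℝ => s ^ n * (1 + s ^ 2) ^ N * Real.exp (-b * s ^ 2)) := by
  induction N with
  | zero => intro n; simpa using sp_int_pow hb n
  | succ N ih =>
    intro n
    refine ((ih n).add (ih (n+2))).congr (Eventually.of_forall fun s => ?_)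
    simp only [Pi.add_apply]
    ring

lemma sp_mom_rec (n : ℕ) :
    ∫ s : ℝ, s ^ (n+2) * Real.exp (-(1/2) * s ^ 2)
      = (n + 1) * ∫ s : ℝ, s ^ n * Real.exp (-(1/2) * s ^ 2) := by
  have hb : (0:ℝ) < 1/2 := by norm_num
  have hi : Integrable (fun s : ℝ => ((n:ℝ)+1) * (s ^ n * Real.exp (-(1/2) * s ^ 2))
      - s ^ (n+2) * Real.exp (-(1/2) * s ^ 2)) :=
    ((sp_int_pow hb n).const_mul _).sub (sp_int_pow hb (n+2))
  have h := integral_eq_zero_of_hasDerivAt_of_integrable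
    (f := fun s : ℝ => s ^ (n+1) * Real.exp (-(1/2) * s ^ 2)) (fun s => ?_) hi (sp_int_pow hb (n+1))
  · rw [integral_sub ((sp_int_pow hb n).const_mul _) (sp_int_pow hb (n+2)),
      integral_const_mul] at h
    linarith
  · have h1 := (hasDerivAt_pow (n+1) s).mul (((hasDerivAt_pow 2 s).const_mul (-(1/2:ℝ))).exp)
    refine h1.congr_deriv ?_
    push_cast
    simp
    ring

lemma sp_mom_one : ∫ s : ℝ, s ^ 1 * Real.exp (-(1/2) * s ^ 2) = 0 := by
  have hb : (0:ℝ) < 1/2 := by norm_num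
  have h := integral_eq_zero_of_hasDerivAt_of_integrable
    (f := fun s : ℝ => - (s ^ 0 * Real.exp (-(1/2) * s ^ 2))) (fun s => ?_) (sp_int_pow hb 1)
    (sp_int_pow hb 0).neg
  · exact h
  · have h1 := (((hasDerivAt_pow 2 s).const_mul (-(1/2:ℝ))).exp).neg
    simp only [pow_zero, one_mul]
    refine h1.congr_deriv ?_
    push_cast
    simp
    ring

lemma sp_mom_zero : ∫ s : ℝ, s ^ 0 * Real.exp (-(1/2) * s ^ 2) = Real.sqrt (2 * Real.pi) := by
  have := integral_gaussian (1/2)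
  simp only [pow_zero, one_mul]
  rw [this]
  congr 1
  ring

def SpJ (F : ℝ → ℝ) (m : ℝ) : Prop :=
  Integrable (fun s : ℝ => F s * Real.exp (-(1/2) * s ^ 2)) ∧
    ∫ s : ℝ, F s * Real.exp (-(1/2) * s ^ 2) = m

lemma SpJ.add {F G : ℝ → ℝ} {a b : ℝ} (hF : SpJ F a) (hG : SpJ G b) :
    SpJ (fun s => F s + G s) (a + b) := by
  have : (fun s : ℝ => (F s + G s) * Real.exp (-(1/2) * s ^ 2))
    = fun s => F s * Real.exp (-(1/2) * s ^ 2) + G s * Real.exp (-(1/2) * s ^ 2) := by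
    funext s; ring
  unfold SpJ
  rw [this]
  exact ⟨hF.1.add hG.1, by rw [integral_add hF.1 hG.1, hF.2, hG.2]⟩

lemma SpJ.cmul {F : ℝ → ℝ} {a : ℝ} (c : ℝ) (hF : SpJ F a) :
    SpJ (fun s => c * F s) (c * a) := by
  unfold SpJ
  simp only [mul_assoc]
  exact ⟨hF.1.const_mul c, by rw [integral_const_mul, hF.2]⟩

lemma SpJ.step {n : ℕ} {a : ℝ} (hF : SpJ (fun s => s ^ n) a) :
    SpJ (fun s => s ^ (n + 2)) ((n + 1) * a) :=
  ⟨sp_int_pow (by norm_num) _, by rw [sp_mom_rec, hF.2]⟩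

noncomputable def spP (e s : ℝ) : ℝ :=
  1 * s ^ 0 + (e * (3 * s ^ 1 + (-1) * s ^ 3) + (e ^ 2 * ((-15/4) * s ^ 4 + (1/2) * s ^ 6)
   + (e ^ 3 * ((-9/4) * s ^ 5 + ((9/4) * s ^ 7 + (-1/6) * s ^ 9))
   + (e ^ 4 * ((81/32) * s ^ 8 + ((-7/8) * s ^ 10 + (1/24) * s ^ 12))
   + e ^ 5 * ((27/32) * s ^ 9 + ((-45/32) * s ^ 11 + ((1/4) * s ^ 13 + (-1/120) * s ^ 15)))))))

noncomputable def spR (e s : ℝ) : ℝ :=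
  (((-117/128)*s^12 + (33/64)*s^14 + (-9/160)*s^16)
  + e * (((-27/128)*s^13 + (63/128)*s^15 + (-9/64)*s^17)
  + e * (((459/2048)*s^16 + (-45/256)*s^18)
  + e * (((81/2048)*s^17 + (-243/2048)*s^19)
  + e * ((-1701/40960)*s^20 + e * ((-243/40960)*s^21))))))

lemma spR_pb : SpPB spR := by
  have hc := fun (c : ℝ) (n : ℕ) => (SpPB.const c).mul (SpPB.var.pow n)
  have he := fun {F : ℝ → ℝ → ℝ} (h : SpPB F) => SpPB.eps.mul h
  unfold spR
  exact (((hc _ 12).add (hc _ 14)).add (hc _ 16)).add (he ((((hc _ 13).add (hc _ 15)).add (hc _ 17)).add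
    (he (((hc _ 16).add (hc _ 18)).add (he (((hc _ 17).add (hc _ 19)).add
    (he ((hc _ 20).add (he (hc _ 21))))))))))

lemma spP_int (e : ℝ) : SpJ (spP e)
    (Real.sqrt (2 * Real.pi) * (1 - 15 / 4 * e ^ 2 - 4095 / 32 * e ^ 4)) := by
  have hb : (0:ℝ) < 1/2 := by norm_num
  have h0 : SpJ (fun s => s ^ 0) (Real.sqrt (2 * Real.pi)) := ⟨sp_int_pow hb 0, sp_mom_zero⟩
  have h1 : SpJ (fun s => s ^ 1) 0 := ⟨sp_int_pow hb 1, sp_mom_one⟩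
  have h2 := h0.step
  have h4 := h2.step
  have h6 := h4.step
  have h8 := h6.step
  have h10 := h8.step
  have h12 := h10.step
  have h3 := h1.step
  have h5 := h3.step
  have h7 := h5.step
  have h9 := h7.step
  have h11 := h9.step
  have h13 := h11.step
  have h15 := h13.step
  have := (h0.cmul 1).add ((((h1.cmul 3).add (h3.cmul (-1))).cmul e).add
    ((((h4.cmul (-15/4)).add (h6.cmul (1/2))).cmul (e^2)).add
    ((((h5.cmul (-9/4)).add ((h7.cmul (9/4)).add (h9.cmul (-1/6)))).cmul (e^3)).add
    ((((h8.cmul (81/32)).add ((h10.cmul (-7/8)).add (h12.cmul (1/24)))).cmul (e^4)).add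
    (((h9.cmul (27/32)).add ((h11.cmul (-45/32)).add ((h13.cmul (1/4)).add
      (h15.cmul (-1/120))))).cmul (e^5))))))
  refine ⟨this.1, this.2.trans ?_⟩
  push_cast
  ring

noncomputable def spf (e s : ℝ) : ℝ := (1 + 3 * e * s) * Real.exp (-(1/2) * s ^ 2 - e * s ^ 3 - 3/4 * e ^ 2 * s ^ 4)

lemma sp_main : ∃ C : ℝ, 0 ≤ C ∧ ∀ e : ℝ, |e| ≤ 1 →
    |(∫ s, spf e s) - Real.sqrt (2 * Real.pi) * (1 - 15 / 4 * e ^ 2 - 4095 / 32 * e ^ 4)|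
      ≤ C * e ^ 6 := by
  have hv : SpPB (fun e s => (-1) * s ^ 3 + (-3/4) * (e * s ^ 4)) :=
    ((SpPB.const (-1)).mul (SpPB.var.pow 3)).add
      ((SpPB.const (-3/4)).mul (SpPB.eps.mul (SpPB.var.pow 4)))
  have hl : SpPB (fun e s => 1 + 3 * e * s) :=
    (SpPB.const 1).add (((SpPB.const 3).mul SpPB.eps).mul SpPB.var)
  obtain ⟨C1, N1, hC1, h1⟩ := hl.mul (hv.pow 6)
  obtain ⟨C2, N2, hC2, h2⟩ := spR_pb
  obtain ⟨C3, N3, hC3, h3⟩ := hl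
  have hb : (0:ℝ) < 1/6 := by norm_num
  set B : ℝ → ℝ := fun s => C1 * (s ^ 0 * (1 + s^2) ^ N1 * Real.exp (-(1/6) * s ^ 2)) +
    C2 * (s ^ 0 * (1 + s^2) ^ N2 * Real.exp (-(1/6) * s ^ 2)) with hB
  have hBi : Integrable B :=
    ((sp_int_pow2 hb N1 0).const_mul C1).add ((sp_int_pow2 hb N2 0).const_mul C2)
  have hB0 : 0 ≤ ∫ s, B s := integral_nonneg fun s => by
    simp only [hB, Pi.zero_apply]; positivity
  refine ⟨∫ s, B s, hB0, fun e he => ?_⟩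
  have hexp : ∀ s : ℝ, Real.exp (-(1/2) * s ^ 2 - e * s ^ 3 - 3/4 * e ^ 2 * s ^ 4)
      ≤ Real.exp (-(1/6) * s ^ 2) := fun s => by
    apply Real.exp_le_exp.2
    nlinarith [sq_nonneg (s * (3/2 * e * s + 1))]
  have hexp2 : ∀ s : ℝ, Real.exp (-(1/2) * s ^ 2) ≤ Real.exp (-(1/6) * s ^ 2) := fun s => by
    apply Real.exp_le_exp.2
    nlinarith [sq_nonneg s]
  have hfi : Integrable (spf e) := by
    refine ((sp_int_pow2 hb N3 0).const_mul C3).mono' ?_ (Eventually.of_forall fun s => ?_)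
    · apply Continuous.aestronglyMeasurable
      unfold spf
      fun_prop
    · rw [Real.norm_eq_abs, spf, abs_mul, abs_of_pos (Real.exp_pos _)]
      calc _ ≤ (C3 * (1 + s^2)^N3) * Real.exp (-(1/6) * s ^ 2) :=
            mul_le_mul (h3 e s he) (hexp s) (Real.exp_pos _).le (by positivity)
        _ = _ := by ring
  obtain ⟨hPi, hPe⟩ := spP_int e
  rw [← hPe, ← integral_sub hfi hPi, ← Real.norm_eq_abs, mul_comm, ← integral_const_mul]
  refine norm_integral_le_of_norm_le (hBi.const_mul _) (Eventually.of_forall fun s => ?_)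
  rw [Real.norm_eq_abs]
  set v := (-1) * s ^ 3 + (-3/4) * (e * s ^ 4) with hvd
  have ht := sp_exp_taylor 6 (e * v)
  set T := ∑ i ∈ Finset.range 6, (e * v) ^ i / (i.factorial : ℝ) with hT
  have hid : spf e s - spP e s * Real.exp (-(1/2) * s ^ 2)
      = (1 + 3 * e * s) * ((Real.exp (e * v) - T) * Real.exp (-(1/2) * s ^ 2))
        + e ^ 6 * (spR e s * Real.exp (-(1/2) * s ^ 2)) := by
    have e1 : spf e s = (1 + 3 * e * s) * (Real.exp (e * v) * Real.exp (-(1/2) * s ^ 2)) := by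
      rw [spf, ← Real.exp_add]; congr 2; rw [hvd]; ring
    have e2 : spP e s + e ^ 6 * spR e s = (1 + 3 * e * s) * T := by
      rw [hT, hvd, spP, spR]
      simp only [Finset.sum_range_succ, Finset.sum_range_zero, Nat.factorial]
      push_cast
      ring
    rw [e1]
    linear_combination (-Real.exp (-(1/2) * s ^ 2)) * e2
  have hmax : max 1 (Real.exp (e * v)) * Real.exp (-(1/2) * s ^ 2) ≤ Real.exp (-(1/6) * s ^ 2) := by
    rcases max_cases 1 (Real.exp (e * v)) with ⟨h, _⟩ | ⟨h, _⟩
    · rw [h, one_mul]; exact hexp2 s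
    · rw [h, ← Real.exp_add]
      refine le_trans (le_of_eq ?_) (hexp s)
      congr 1; rw [hvd]; ring
  have hA : |(1 + 3 * e * s) * ((Real.exp (e * v) - T) * Real.exp (-(1/2) * s ^ 2))|
      ≤ e ^ 6 * (C1 * (1 + s^2) ^ N1 * Real.exp (-(1/6) * s ^ 2)) := by
    have h1s := h1 e s he
    simp only [← hvd] at h1s
    rw [abs_mul, abs_mul, abs_of_pos (Real.exp_pos _)]
    have hv6 : |v| ^ 6 = v ^ 6 := Even.pow_abs (by decide) v
    have he6 : |e| ^ 6 = e ^ 6 := Even.pow_abs (by decide) e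
    have hv6' : |v ^ 6| = v ^ 6 := abs_of_nonneg (by positivity)
    rw [abs_mul, hv6'] at h1s
    rw [abs_mul, mul_pow, hv6, he6] at ht
    calc _ ≤ |1 + 3 * e * s| * ((e ^ 6 * v ^ 6 * max 1 (Real.exp (e * v))) * Real.exp (-(1/2) * s ^ 2)) := by
          gcongr
      _ = e ^ 6 * ((|1 + 3 * e * s| * v ^ 6) * (max 1 (Real.exp (e * v)) * Real.exp (-(1/2) * s ^ 2))) := by ring
      _ ≤ _ := by gcongr
  have hD : |e ^ 6 * (spR e s * Real.exp (-(1/2) * s ^ 2))|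
      ≤ e ^ 6 * (C2 * (1 + s^2) ^ N2 * Real.exp (-(1/6) * s ^ 2)) := by
    rw [abs_mul, abs_mul, abs_of_pos (Real.exp_pos _), abs_of_nonneg (by positivity : 0 ≤ e ^ 6)]
    have h2s := h2 e s he
    have h3s := hexp2 s
    gcongr
  rw [hid]
  refine (abs_add_le _ _).trans ((add_le_add hA hD).trans (le_of_eq ?_))
  simp only [hB]
  ring

lemma sp_cov {l v e : ℝ} (hl : 0 < l) (hv : 0 < v) (he : 0 < e) :
    (∫ x : ℝ, x * Real.exp (- (l ^ 4 * v ^ 4 / 4) * x ^ 4 + v ^ 4 * x * (e ^ 3 / l ^ 2)))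
      = 1 / (Real.sqrt 3 * v ^ 2 * l ^ 2) * Real.exp (3 * v ^ 4 * (e ^ 2) ^ 2 / (4 * l ^ 4))
        * ∫ s, spf (l ^ 2 / (3 * Real.sqrt 3 * v ^ 2 * e ^ 2)) s := by
  set r := Real.sqrt 3 with hr
  have hr0 : 0 < r := Real.sqrt_pos.2 (by norm_num)
  have hr2 : r ^ 2 = 3 := Real.sq_sqrt (by norm_num)
  set F : ℝ → ℝ := fun x => x * Real.exp (- (l ^ 4 * v ^ 4 / 4) * x ^ 4 + v ^ 4 * x * (e ^ 3 / l ^ 2)) with hF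
  set b := 1 / (r * v ^ 2 * e) with hb
  have hb0 : 0 < b := by positivity
  have h1 : ∫ x, F x = ∫ x, F (x + e / l ^ 2) := (integral_add_right_eq_self F _).symm
  have h2 := Measure.integral_comp_mul_left (fun x => F (x + e / l ^ 2)) b
  rw [smul_eq_mul, abs_of_pos (inv_pos.2 hb0), ← h1] at h2
  have h3 : ∫ x, F x = b * ∫ s, F (b * s + e / l ^ 2) := by
    rw [h2]; field_simp
  rw [h3, ← integral_const_mul, ← integral_const_mul]
  congr 1
  funext s
  simp only [hF, spf]
  have hE : - (l ^ 4 * v ^ 4 / 4) * (b * s + e / l ^ 2) ^ 4 + v ^ 4 * (b * s + e / l ^ 2) * (e ^ 3 / l ^ 2)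
    = 3 * v ^ 4 * (e ^ 2) ^ 2 / (4 * l ^ 4) + (-(1/2) * s ^ 2 - (l ^ 2 / (3 * r * v ^ 2 * e ^ 2)) * s ^ 3
      - 3/4 * (l ^ 2 / (3 * r * v ^ 2 * e ^ 2)) ^ 2 * s ^ 4) := by
    have hr4 : r ^ 4 = 9 := by rw [show r ^ 4 = (r ^ 2) ^ 2 by ring, hr2]; norm_num
    have hri : r⁻¹ ^ 2 = 1 / 3 := by rw [inv_pow, hr2]; norm_num
    have hb' : b = r⁻¹ * (v ^ 2 * e)⁻¹ := by rw [hb]; field_simp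
    have hep : l ^ 2 / (3 * r * v ^ 2 * e ^ 2) = r⁻¹ * (l ^ 2 / (3 * v ^ 2 * e ^ 2)) := by field_simp
    rw [hep, hb']
    generalize r⁻¹ = q at hri
    have hq3 : q ^ 3 = q / 3 := by rw [pow_succ, hri]; ring
    have hq4 : q ^ 4 = 1 / 9 := by rw [show q ^ 4 = (q ^ 2) ^ 2 by ring, hri]; norm_num
    have hL : - (l ^ 4 * v ^ 4 / 4) * (q * (v ^ 2 * e)⁻¹ * s + e / l ^ 2) ^ 4
        + v ^ 4 * (q * (v ^ 2 * e)⁻¹ * s + e / l ^ 2) * (e ^ 3 / l ^ 2)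
      = 3 * v ^ 4 * (e ^ 2) ^ 2 / (4 * l ^ 4) - 3 / 2 * q ^ 2 * s ^ 2
        - q ^ 3 * (l ^ 2 / (v ^ 2 * e ^ 2)) * s ^ 3
        - q ^ 4 * (l ^ 4 / (4 * v ^ 4 * e ^ 4)) * s ^ 4 := by
      field_simp
      ring
    rw [hL, hq3, hq4, hri, mul_pow, hri]
    field_simp
    ring
  rw [hE, Real.exp_add]
  have hX : b * (b * s + e / l ^ 2) = 1 / (r * v ^ 2 * l ^ 2) * (1 + 3 * (l ^ 2 / (3 * r * v ^ 2 * e ^ 2)) * s) := by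
    rw [hb]
    field_simp
    ring
  rw [← mul_assoc, hX]
  ring

lemma sp_rpow {x y : ℝ} (hx : 0 < x) (k n : ℕ) (h : y * k = n) : (x ^ k) ^ y = x ^ n := by
  rw [← Real.rpow_natCast x k, ← Real.rpow_mul hx.le, mul_comm, h, Real.rpow_natCast]

lemma sp_final (v e : ℝ) (hv : 0 < v) (he : 0 < e) : ∃ K δ : ℝ, 0 < δ ∧ ∀ l : ℝ, 0 < l → l ^ 4 < δ →
    |(∫ x : ℝ, x * Real.exp (- (l ^ 4 * v ^ 4 / 4) * x ^ 4 + v ^ 4 * x * (e ^ 3 / l ^ 2)))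
          / (Real.sqrt (Real.pi * l ^ 2 / (3 * v ^ 2 * e ^ 2))
              * Real.exp (3 * v ^ 4 * (e ^ 2) ^ 2 / (4 * l ^ 4)))
        - (Real.sqrt 2 * e / (l ^ 3 * v)
            - 5 * l / (18 * Real.sqrt 2 * e ^ 3 * v ^ 5)
            - 455 * l ^ 5 / (1296 * Real.sqrt 2 * e ^ 7 * v ^ 9))| ≤ K * l ^ 9 := by
  obtain ⟨C, hC, hmain⟩ := sp_main
  set r := Real.sqrt 3 with hr
  have hr0 : 0 < r := Real.sqrt_pos.2 (by norm_num)
  have hr2 : r ^ 2 = 3 := Real.sq_sqrt (by norm_num)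
  set p := Real.sqrt Real.pi with hp
  have hp0 : 0 < p := Real.sqrt_pos.2 Real.pi_pos
  set t := Real.sqrt 2 with ht
  have ht0 : 0 < t := Real.sqrt_pos.2 (by norm_num)
  have ht2 : t ^ 2 = 2 := Real.sq_sqrt (by norm_num)
  refine ⟨e / (p * v) * (C * (1 / (3 * r * v ^ 2 * e ^ 2)) ^ 6), (3 * r * v ^ 2 * e ^ 2) ^ 2,
    by positivity, fun l hl hlt => ?_⟩
  rw [sp_cov hl hv he]
  set ε := l ^ 2 / (3 * r * v ^ 2 * e ^ 2) with hε
  have hε0 : 0 < ε := by positivity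
  have hε1 : |ε| ≤ 1 := by
    rw [abs_of_pos hε0, hε, div_le_one (by positivity)]
    refine le_of_lt (lt_of_pow_lt_pow_left₀ 2 (by positivity) ?_)
    calc (l ^ 2) ^ 2 = l ^ 4 := by ring
      _ < _ := hlt
  have hm := hmain ε hε1
  set G := ∫ s, spf ε s with hG
  have hsq : Real.sqrt (Real.pi * l ^ 2 / (3 * v ^ 2 * e ^ 2)) = p * l / (r * v * e) := by
    rw [show Real.pi * l ^ 2 / (3 * v ^ 2 * e ^ 2) = (p * l / (r * v * e)) ^ 2 by
      rw [div_pow, mul_pow, mul_pow, mul_pow, hr2, hp, Real.sq_sqrt Real.pi_pos.le]]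
    exact Real.sqrt_sq (by positivity)
  have h2p : Real.sqrt (2 * Real.pi) = t * p := Real.sqrt_mul (by norm_num) _
  rw [h2p] at hm
  rw [hsq]
  have hε2 : ε ^ 2 = l ^ 4 / (27 * v ^ 4 * e ^ 4) := by
    rw [hε, div_pow]; congr 1
    · ring
    · linear_combination 9 * v ^ 4 * e ^ 4 * hr2
  have hε4 : ε ^ 4 = l ^ 8 / (729 * v ^ 8 * e ^ 8) := by
    rw [show ε ^ 4 = (ε ^ 2) ^ 2 by ring, hε2]; field_simp; norm_num
  have hid : 1 / (r * v ^ 2 * l ^ 2) * Real.exp (3 * v ^ 4 * (e ^ 2) ^ 2 / (4 * l ^ 4)) * G /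
        (p * l / (r * v * e) * Real.exp (3 * v ^ 4 * (e ^ 2) ^ 2 / (4 * l ^ 4)))
        - (t * e / (l ^ 3 * v) - 5 * l / (18 * t * e ^ 3 * v ^ 5)
            - 455 * l ^ 5 / (1296 * t * e ^ 7 * v ^ 9))
      = e / (p * v * l ^ 3) * (G - t * p * (1 - 15 / 4 * ε ^ 2 - 4095 / 32 * ε ^ 4)) := by
    have hexp := (Real.exp_pos (3 * v ^ 4 * (e ^ 2) ^ 2 / (4 * l ^ 4))).ne'
    have hti : ∀ a b : ℝ, b ≠ 0 → a / (t * b) = t * (a / (2 * b)) := fun a b hb => by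
      rw [← ht2]; field_simp
    have g1 : 5 * l / (18 * t * e ^ 3 * v ^ 5) = t * (5 * l / (36 * e ^ 3 * v ^ 5)) := by
      rw [show 18 * t * e ^ 3 * v ^ 5 = t * (18 * e ^ 3 * v ^ 5) by ring, hti _ _ (by positivity)]
      congr 2; ring
    have g2 : 455 * l ^ 5 / (1296 * t * e ^ 7 * v ^ 9) = t * (455 * l ^ 5 / (2592 * e ^ 7 * v ^ 9)) := by
      rw [show 1296 * t * e ^ 7 * v ^ 9 = t * (1296 * e ^ 7 * v ^ 9) by ring, hti _ _ (by positivity)]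
      congr 2; ring
    have g3 : 1 / (r * v ^ 2 * l ^ 2) * Real.exp (3 * v ^ 4 * (e ^ 2) ^ 2 / (4 * l ^ 4)) * G /
        (p * l / (r * v * e) * Real.exp (3 * v ^ 4 * (e ^ 2) ^ 2 / (4 * l ^ 4)))
        = e / (p * v * l ^ 3) * G := by
      generalize Real.exp (3 * v ^ 4 * (e ^ 2) ^ 2 / (4 * l ^ 4)) = Q at hexp
      field_simp
    rw [g1, g2, g3, hε2, hε4, mul_sub, sub_right_inj]
    field_simp
    ring
  rw [hid, abs_mul, abs_of_pos (by positivity : 0 < e / (p * v * l ^ 3))]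
  calc _ ≤ e / (p * v * l ^ 3) * (C * ε ^ 6) := by gcongr
    _ = _ := by rw [hε]; field_simp

/-- Saddle-point asymptotics of `∫ x exp(−(λV/4)x⁴ + VxE^{3/2}/√λ)dx`:
with `C′(λ) = √(π√λ/(3√V E)) exp(3VE²/(4λ))`, as `λ → 0⁺` the normalized integral equals
`√2√E/(λ^{3/4}V^{1/4}) − 5λ^{1/4}/(18√2 E^{3/2} V^{5/4})
  − 455λ^{5/4}/(1296√2 E^{7/2} V^{9/4}) + O(λ^{9/4})`. -/
theorem saddle_point_dP
    (Vc E : ℝ) (hV : 0 < Vc) (hE : 0 < E) :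
    (fun lam : ℝ =>
        (∫ x : ℝ, x * Real.exp (- (lam * Vc / 4) * x ^ 4
            + Vc * x * (E ^ ((3 : ℝ) / 2) / Real.sqrt lam)))
          / (Real.sqrt (Real.pi * Real.sqrt lam / (3 * Real.sqrt Vc * E))
              * Real.exp (3 * Vc * E ^ 2 / (4 * lam)))
        - (Real.sqrt 2 * Real.sqrt E / (lam ^ ((3 : ℝ) / 4) * Vc ^ ((1 : ℝ) / 4))
            - 5 * lam ^ ((1 : ℝ) / 4)
                / (18 * Real.sqrt 2 * E ^ ((3 : ℝ) / 2) * Vc ^ ((5 : ℝ) / 4))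
            - 455 * lam ^ ((5 : ℝ) / 4)
                / (1296 * Real.sqrt 2 * E ^ ((7 : ℝ) / 2) * Vc ^ ((9 : ℝ) / 4))))
      =O[nhdsWithin 0 (Set.Ioi 0)] fun lam : ℝ => lam ^ ((9 : ℝ) / 4) := by
  set v := Vc ^ ((1:ℝ)/4) with hvd
  set e := Real.sqrt E with hed
  have hv : 0 < v := Real.rpow_pos_of_pos hV _
  have he : 0 < e := Real.sqrt_pos.2 hE
  have hVv : Vc = v ^ 4 := by
    rw [hvd, ← Real.rpow_natCast, ← Real.rpow_mul hV.le]; norm_num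
  have hEe : E = e ^ 2 := (Real.sq_sqrt hE.le).symm
  clear_value v e
  subst hVv hEe
  obtain ⟨K, δ, hδ, hK⟩ := sp_final v e hv he
  refine IsBigO.of_bound K ?_
  have hmem : Set.Ioo 0 δ ∈ nhdsWithin (0:ℝ) (Set.Ioi 0) := Ioo_mem_nhdsGT hδ
  filter_upwards [hmem] with lam hlam
  obtain ⟨hlam0, hlamδ⟩ := hlam
  obtain ⟨l, hl, rfl⟩ : ∃ l : ℝ, 0 < l ∧ lam = l ^ 4 :=
    ⟨lam ^ ((1:ℝ)/4), Real.rpow_pos_of_pos hlam0 _, by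
      rw [← Real.rpow_natCast, ← Real.rpow_mul hlam0.le]; norm_num⟩
  have h := hK l hl hlamδ
  have a1 : Real.sqrt (l ^ 4) = l ^ 2 := by
    rw [show l ^ 4 = (l ^ 2) ^ 2 by ring]; exact Real.sqrt_sq (by positivity)
  have a2 : Real.sqrt (v ^ 4) = v ^ 2 := by
    rw [show v ^ 4 = (v ^ 2) ^ 2 by ring]; exact Real.sqrt_sq (by positivity)
  have b1 : (l ^ 4) ^ ((3:ℝ)/4) = l ^ 3 := sp_rpow hl 4 3 (by norm_num)
  have b2 : (l ^ 4) ^ ((1:ℝ)/4) = l := by simpa using sp_rpow hl 4 1 (y := (1:ℝ)/4) (by norm_num)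
  have b3 : (l ^ 4) ^ ((5:ℝ)/4) = l ^ 5 := sp_rpow hl 4 5 (by norm_num)
  have b4 : (l ^ 4) ^ ((9:ℝ)/4) = l ^ 9 := sp_rpow hl 4 9 (by norm_num)
  have c3 : (v ^ 4) ^ ((5:ℝ)/4) = v ^ 5 := sp_rpow hv 4 5 (by norm_num)
  have c4 : (v ^ 4) ^ ((9:ℝ)/4) = v ^ 9 := sp_rpow hv 4 9 (by norm_num)
  have d1 : (e ^ 2) ^ ((3:ℝ)/2) = e ^ 3 := sp_rpow he 2 3 (by norm_num)
  have d2 : (e ^ 2) ^ ((7:ℝ)/2) = e ^ 7 := sp_rpow he 2 7 (by norm_num)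
  rw [a1, a2, b1, b2, b3, b4, c3, c4, d1, d2, Real.norm_eq_abs, Real.norm_eq_abs,
    abs_of_pos (by positivity : 0 < l ^ 9)]
  exact h
end

section
/- Fix reals V > 0 and E₀ > 0, and for λ > 0 set S_λ(x) = V((3/2)E₀x² + √λ·√E₀·x³ + (λ/4)x⁴). Then the one-point function G_{|1|}(λ) = (∫_ℝ x·exp(−S_λ(x)) dx)/(∫_ℝ exp(−S_λ(x)) dx) satisfies, as λ → 0⁺, G_{|1|}(λ) + √λ/(3V·E₀^{3/2}) + 7λ^{3/2}/(27V²·E₀^{7/2}) = O(λ^{5/2}). -/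
open MeasureTheory Filter Asymptotics

/-- The Boltzmann weight. -/
noncomputable def bw (V s g x : ℝ) : ℝ :=
  Real.exp (- (V * ((3 / 2) * s ^ 2 * x ^ 2 + g * s * x ^ 3 + (g ^ 2 / 4) * x ^ 4)))

/-- The moments. -/
noncomputable def mom (V s g : ℝ) (k : ℕ) : ℝ := ∫ x : ℝ, x ^ k * bw V s g x

lemma bw_le (V s g x : ℝ) (hV : 0 < V) :
    bw V s g x ≤ Real.exp (-(V * s ^ 2 / 2) * x ^ 2) := by
  unfold bw
  apply Real.exp_le_exp.mpr
  have : 0 ≤ V * (x ^ 2 * (g * x / 2 + s) ^ 2) := by positivity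
  nlinarith [this]

lemma gauss_int (b : ℝ) (hb : 0 < b) (k : ℕ) :
    Integrable (fun x : ℝ => x ^ k * Real.exp (-b * x ^ 2)) := by
  have h := integrable_rpow_mul_exp_neg_mul_sq hb (s := (k : ℝ))
    (by have : (0 : ℝ) ≤ k := Nat.cast_nonneg k
        linarith)
  simpa [Real.rpow_natCast] using h

lemma abs_le_aux (V s g : ℝ) (hV : 0 < V) (k : ℕ) (x : ℝ) :
    ‖x ^ k * bw V s g x‖ ≤ ‖x ^ k * Real.exp (-(V * s ^ 2 / 2) * x ^ 2)‖ := by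
  rw [norm_mul, norm_mul]
  have h1 := bw_le V s g x hV
  have h0 : 0 < bw V s g x := Real.exp_pos _
  rw [Real.norm_of_nonneg h0.le, Real.norm_of_nonneg (Real.exp_pos _).le]
  gcongr

lemma mom_int (V s g : ℝ) (hV : 0 < V) (hs : 0 < s) (k : ℕ) :
    Integrable (fun x : ℝ => x ^ k * bw V s g x) := by
  refine (gauss_int (V * s ^ 2 / 2) (by positivity) k).mono ?_
    (Eventually.of_forall fun x => abs_le_aux V s g hV k x)
  apply Continuous.aestronglyMeasurable
  unfold bw
  fun_prop

lemma mom_bound (V s : ℝ) (hV : 0 < V) (hs : 0 < s) (k : ℕ) :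
    ∃ C, 0 ≤ C ∧ ∀ g, |mom V s g k| ≤ C := by
  refine ⟨∫ x : ℝ, ‖x ^ k * Real.exp (-(V * s ^ 2 / 2) * x ^ 2)‖,
    integral_nonneg fun x => norm_nonneg _, fun g => ?_⟩
  refine (norm_integral_le_integral_norm (fun x : ℝ => x ^ k * bw V s g x)).trans ?_
  exact integral_mono (mom_int V s g hV hs k).norm
    (gauss_int (V * s ^ 2 / 2) (by positivity) k).norm (fun x => abs_le_aux V s g hV k x)

lemma mom_zero_lower (V s : ℝ) (hV : 0 < V) (hs : 0 < s) :
    ∃ c, 0 < c ∧ ∀ g, 0 < g → g ≤ 1 → c ≤ mom V s g 0 := by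
  have hle : ∀ g : ℝ, 0 < g → g ≤ 1 → ∀ x : ℝ,
      Real.exp (-(V * ((3 / 2) * s ^ 2 * x ^ 2 + s * |x| ^ 3 + (1 / 4) * x ^ 4)))
        ≤ bw V s g x := by
    intro g h0 h1 x
    unfold bw
    apply Real.exp_le_exp.mpr
    have h3 : g * s * x ^ 3 ≤ s * |x| ^ 3 := by
      have : x ^ 3 ≤ |x| ^ 3 := by rw [← abs_pow]; exact le_abs_self _
      calc g * s * x ^ 3 ≤ g * s * |x| ^ 3 := by gcongr
        _ ≤ 1 * s * |x| ^ 3 := by gcongr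
        _ = _ := by ring
    have h4 : g ^ 2 / 4 * x ^ 4 ≤ 1 / 4 * x ^ 4 := by
      have : g ^ 2 ≤ 1 := by nlinarith
      gcongr
    apply neg_le_neg
    gcongr
  have hi : Integrable fun x : ℝ =>
      Real.exp (-(V * ((3 / 2) * s ^ 2 * x ^ 2 + s * |x| ^ 3 + (1 / 4) * x ^ 4))) := by
    refine (mom_int V s 1 hV hs 0).mono (Continuous.aestronglyMeasurable (by fun_prop))
      (Eventually.of_forall fun x => ?_)
    have := hle 1 one_pos le_rfl x
    rw [pow_zero, one_mul, Real.norm_of_nonneg (Real.exp_pos _).le]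
    exact this.trans (le_abs_self _)
  refine ⟨_, integral_exp_pos hi, fun g h0 h1 => ?_⟩
  refine integral_mono hi (mom_int V s g hV hs 0) fun x => ?_
  simpa using hle g h0 h1 x

lemma bw_deriv (V s g x : ℝ) : HasDerivAt (bw V s g)
    (bw V s g x * (-(V * (3 * s ^ 2 * x + 3 * g * s * x ^ 2 + g ^ 2 * x ^ 3)))) x := by
  unfold bw
  apply HasDerivAt.exp
  have h := (((((hasDerivAt_pow 2 x).const_mul ((3 / 2) * s ^ 2)).add
    ((hasDerivAt_pow 3 x).const_mul (g * s))).add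
    ((hasDerivAt_pow 4 x).const_mul (g ^ 2 / 4))).const_mul V).neg
  refine h.congr_deriv ?_
  push_cast
  ring

lemma sd (V s g : ℝ) (hV : 0 < V) (hs : 0 < s) (k : ℕ) :
    (k : ℝ) * mom V s g (k - 1) - V * (3 * s ^ 2 * mom V s g (k + 1)
      + 3 * g * s * mom V s g (k + 2) + g ^ 2 * mom V s g (k + 3)) = 0 := by
  have I := mom_int V s g hV hs
  have i0 := (I (k - 1)).const_mul (k : ℝ)
  have i1 := (I (k + 1)).const_mul (3 * s ^ 2)
  have i2 := (I (k + 2)).const_mul (3 * g * s)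
  have i3 := (I (k + 3)).const_mul (g ^ 2)
  have i := i0.sub (((i1.add i2).add i3).const_mul V)
  have key := integral_eq_zero_of_hasDerivAt_of_integrable
    (f := fun x : ℝ => x ^ k * bw V s g x) (fun x => by
      have h := (hasDerivAt_pow k x).mul (bw_deriv V s g x)
      refine h.congr_deriv ?_
      change _ = (k : ℝ) * (x ^ (k - 1) * bw V s g x)
        - V * (3 * s ^ 2 * (x ^ (k + 1) * bw V s g x)
        + 3 * g * s * (x ^ (k + 2) * bw V s g x) + g ^ 2 * (x ^ (k + 3) * bw V s g x))
      ring) i (I k)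
  rw [integral_sub' i0 (((i1.add i2).add i3).const_mul V), integral_const_mul,
    integral_const_mul, integral_add' (i1.add i2) i3, integral_add' i1 i2,
    integral_const_mul, integral_const_mul, integral_const_mul] at key
  exact key

lemma main_bound (V s : ℝ) (hV : 0 < V) (hs : 0 < s) :
    ∃ C, ∀ g, 0 < g → g ≤ 1 →
      |mom V s g 1 / mom V s g 0 + g / (3 * V * s ^ 3) + 7 * g ^ 3 / (27 * V ^ 2 * s ^ 7)|
        ≤ C * g ^ 5 := by
  obtain ⟨c, hc, hcl⟩ := mom_zero_lower V s hV hs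
  choose M hM0 hM using mom_bound V s hV hs
  obtain ⟨u, hu⟩ : ∃ u, u = s⁻¹ := ⟨_, rfl⟩
  obtain ⟨w, hw⟩ : ∃ w, w = V⁻¹ := ⟨_, rfl⟩
  have hu0 : 0 < u := by rw [hu]; positivity
  have hw0 : 0 < w := by rw [hw]; positivity
  refine ⟨((14/27)*u^9*w^2 * M 2 + (14/81)*u^10*w^2 * M 3 + (14/27)*u^7*w * M 4
    + (7/27)*u^8*w * M 5 + (1/27)*u^6 * M 7) / c, fun g hg hg1 => ?_⟩
  have h : ∀ k : ℕ, mom V s g (k + 1) - u ^ 2 * w / 3 * k * mom V s g (k - 1)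
      + u * g * mom V s g (k + 2) + u ^ 2 / 3 * g ^ 2 * mom V s g (k + 3) = 0 := by
    intro k
    have h := sd V s g hV hs k
    rw [hu, hw]
    field_simp
    linear_combination (-1) * h
  have hpos : 0 < mom V s g 0 := hc.trans_le (hcl g hg hg1)
  have h0 := h 0
  have h1 := h 1
  have h2 := h 2
  have h3 := h 3
  have h4 := h 4
  norm_num at h0 h1 h2 h3 h4
  have e : mom V s g 1 / mom V s g 0 + g / (3 * V * s ^ 3) + 7 * g ^ 3 / (27 * V ^ 2 * s ^ 7)
      = ((-(14/27)*u^9*w^2) * mom V s g 2 + (-(14/81)*u^10*w^2 * g) * mom V s g 3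
        + (-(14/27)*u^7*w) * mom V s g 4 + (-(7/27)*u^8*w*g) * mom V s g 5
        + (-(1/27)*u^6*g) * mom V s g 7) * g ^ 5 / mom V s g 0 := by
    have e1 : g / (3 * V * s ^ 3) = g * u ^ 3 * w / 3 := by rw [hu, hw]; field_simp
    have e2 : 7 * g ^ 3 / (27 * V ^ 2 * s ^ 7) = 7 * g ^ 3 * u ^ 7 * w ^ 2 / 27 := by
      rw [hu, hw]; field_simp
    rw [e1, e2]
    field_simp
    linear_combination 6561 * (((1/1)*u^0*w^0*g^0 + (4/9)*u^4*w^1*g^2 + (14/27)*u^8*w^2*g^4) * h0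
      + ((-1/1)*u^1*w^0*g^1 + (-7/9)*u^5*w^1*g^3) * h1
      + ((2/3)*u^2*w^0*g^2 + (7/9)*u^6*w^1*g^4) * h2
      + ((-1/3)*u^3*w^0*g^3) * h3
      + ((1/9)*u^4*w^0*g^4) * h4)
  have t : ∀ (a b : ℝ) (k : ℕ), 0 ≤ a → |b| ≤ a → |b * mom V s g k| ≤ a * M k := by
    intro a b k ha hb
    rw [abs_mul]
    exact mul_le_mul hb (hM k g) (abs_nonneg _) ha
  have T : ∀ (a : ℝ), 0 ≤ a → |(-a * g)| ≤ a := by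
    intro a ha
    rw [abs_mul, abs_neg, abs_of_nonneg ha, abs_of_pos hg]
    nlinarith
  have T' : ∀ (a : ℝ), 0 ≤ a → |(-a)| ≤ a := by
    intro a ha
    rw [abs_neg, abs_of_nonneg ha]
  have b2 := t ((14/27)*u^9*w^2) (-(14/27)*u^9*w^2) 2 (by positivity)
    (by simpa only [neg_mul] using T' ((14/27)*u^9*w^2) (by positivity))
  have b3 := t ((14/81)*u^10*w^2) (-(14/81)*u^10*w^2 * g) 3 (by positivity)
    (by simpa only [neg_mul] using T ((14/81)*u^10*w^2) (by positivity))
  have b4 := t ((14/27)*u^7*w) (-(14/27)*u^7*w) 4 (by positivity)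
    (by simpa only [neg_mul] using T' ((14/27)*u^7*w) (by positivity))
  have b5 := t ((7/27)*u^8*w) (-(7/27)*u^8*w*g) 5 (by positivity)
    (by simpa only [neg_mul] using T ((7/27)*u^8*w) (by positivity))
  have b7 := t ((1/27)*u^6) (-(1/27)*u^6*g) 7 (by positivity)
    (by simpa only [neg_mul] using T ((1/27)*u^6) (by positivity))
  have hM2 := hM0 2
  have hM3 := hM0 3
  have hM4 := hM0 4
  have hM5 := hM0 5
  have hM7 := hM0 7
  rw [e, abs_div, abs_mul, abs_of_pos hpos, abs_of_pos (pow_pos hg 5), div_mul_eq_mul_div]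
  apply div_le_div₀ (by positivity) _ hc (hcl g hg hg1)
  apply mul_le_mul_of_nonneg_right _ (by positivity)
  refine (abs_add_le _ _).trans (add_le_add ?_ b7)
  refine (abs_add_le _ _).trans (add_le_add ?_ b5)
  refine (abs_add_le _ _).trans (add_le_add ?_ b4)
  exact (abs_add_le _ _).trans (add_le_add b2 b3)

/-- The `N = 1` one-point function
`G_{|1|}(λ) = (∫ x exp(−S_λ(x)) dx)/(∫ exp(−S_λ(x)) dx)` of the Φ³–Φ⁴ hybrid model,
with `S_λ(x) = V((3/2)E₀x² + √λ √E₀ x³ + (λ/4)x⁴)`, satisfies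
`G_{|1|}(λ) = −√λ/(3V E₀^{3/2}) − 7λ^{3/2}/(27V² E₀^{7/2}) + O(λ^{5/2})` as `λ → 0⁺`. -/
theorem one_point_function_N1_asymptotics
    (Vc E0 : ℝ) (hV : 0 < Vc) (hE : 0 < E0) :
    (fun lam : ℝ =>
        (∫ x : ℝ, x * Real.exp (- (Vc * ((3 / 2) * E0 * x ^ 2
            + Real.sqrt lam * Real.sqrt E0 * x ^ 3 + (lam / 4) * x ^ 4))))
          / (∫ x : ℝ, Real.exp (- (Vc * ((3 / 2) * E0 * x ^ 2
            + Real.sqrt lam * Real.sqrt E0 * x ^ 3 + (lam / 4) * x ^ 4))))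
        + Real.sqrt lam / (3 * Vc * E0 ^ ((3 : ℝ) / 2))
        + 7 * lam ^ ((3 : ℝ) / 2) / (27 * Vc ^ 2 * E0 ^ ((7 : ℝ) / 2)))
      =O[nhdsWithin 0 (Set.Ioi 0)] fun lam : ℝ => lam ^ ((5 : ℝ) / 2) := by
  obtain ⟨C, hC⟩ := main_bound Vc (Real.sqrt E0) hV (Real.sqrt_pos.mpr hE)
  apply IsBigO.of_bound C
  filter_upwards [Ioc_mem_nhdsGT (zero_lt_one' ℝ)] with lam hlam
  obtain ⟨h0, h1⟩ := hlam
  have hp : ∀ (y : ℝ) (n : ℕ), 0 < y → y ^ ((n : ℝ) / 2) = Real.sqrt y ^ n := by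
    intro y n hy
    rw [Real.sqrt_eq_rpow, ← Real.rpow_natCast, ← Real.rpow_mul hy.le]
    congr 1
    ring
  have p1 := hp lam 3 h0
  have p2 := hp lam 5 h0
  have p3 := hp E0 3 hE
  have p4 := hp E0 7 hE
  norm_num only [Nat.cast_ofNat] at p1 p2 p3 p4
  have hg := Real.sqrt_pos.mpr h0
  have key := hC (Real.sqrt lam) hg (Real.sqrt_le_one.mpr h1)
  have q1 := Real.sq_sqrt h0.le
  have q2 := Real.sq_sqrt hE.le
  simp only [mom, bw, pow_zero, one_mul, pow_one, q1, q2] at key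
  rw [p1, p2, p3, p4, Real.norm_eq_abs, Real.norm_of_nonneg (by positivity)]
  exact key
end
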